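/- arXiv:2308.00940 — 2 statements merged into one kernel-verified Lean document; each statement's English description precedes it below -/
import Mathlib

section
/- Let G : ℝ → ℝ be a smooth function satisfying G > 0, G' < 0 and G·G'' ≤ A·(G')² everywhere, where A is a constant with 0 < A ≤ 2. Let u : ℝ² → ℝ be a smooth convex solution of Δu = G(u) on ℝ². If the function x ↦ det(D²u(x)) attains a local minimum at some point of ℝ², then det(D²u(x)) = 0 for every x ∈ ℝ². -/
/-- The Hessian matrix of `u : ℝⁿ → ℝ` at `x`, with entries `∂²u/∂xᵢ∂xⱼ(x)`. -/
noncomputable def hessian {n : ℕ} (u : EuclideanSpace ℝ (Fin n) → ℝ)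
    (x : EuclideanSpace ℝ (Fin n)) : Matrix (Fin n) (Fin n) ℝ :=
  Matrix.of fun i j =>
    iteratedFDeriv ℝ 2 u x
      ![EuclideanSpace.basisFun (Fin n) ℝ i, EuclideanSpace.basisFun (Fin n) ℝ j]

abbrev E2 := EuclideanSpace ℝ (Fin 2)

noncomputable def pd (i : Fin 2) (f : E2 → ℝ) (x : E2) : ℝ :=
  fderiv ℝ f x (EuclideanSpace.basisFun (Fin 2) ℝ i)

abbrev Sm (f : E2 → ℝ) : Prop := ContDiff ℝ (⊤ : ℕ∞) f

lemma Sm.da {f : E2 → ℝ} (hf : Sm f) (x : E2) : DifferentiableAt ℝ f x :=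
  (hf.differentiable (by simp)) x

lemma Sm.pd {f : E2 → ℝ} (hf : Sm f) (i : Fin 2) : Sm (pd i f) := by
  have h : ContDiff ℝ (⊤ : ℕ∞) (fderiv ℝ f) := hf.fderiv_right (by simp)
  exact h.clm_apply contDiff_const

lemma pd_add {f g : E2 → ℝ} (hf : Sm f) (hg : Sm g) (i : Fin 2) :
    pd i (fun x => f x + g x) = fun x => pd i f x + pd i g x := by
  funext x
  unfold pd
  rw [fderiv_fun_add (hf.da x) (hg.da x)]; rfl

lemma pd_sub {f g : E2 → ℝ} (hf : Sm f) (hg : Sm g) (i : Fin 2) :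
    pd i (fun x => f x - g x) = fun x => pd i f x - pd i g x := by
  funext x
  unfold pd
  rw [fderiv_fun_sub (hf.da x) (hg.da x)]; rfl

lemma pd_mul {f g : E2 → ℝ} (hf : Sm f) (hg : Sm g) (i : Fin 2) :
    pd i (fun x => f x * g x) = fun x => f x * pd i g x + pd i f x * g x := by
  funext x
  unfold pd
  rw [fderiv_fun_mul (hf.da x) (hg.da x)]
  simp; ring

lemma pd_const (k : ℝ) (i : Fin 2) : pd i (fun _ => k) = fun _ => 0 := by
  funext x
  simp [pd]

lemma pd_comp {G : ℝ → ℝ} {f : E2 → ℝ} (hG : Differentiable ℝ G) (hf : Sm f) (i : Fin 2) :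
    pd i (fun x => G (f x)) = fun x => deriv G (f x) * pd i f x := by
  funext x
  have h := ((hG (f x)).hasDerivAt.comp_hasFDerivAt x (hf.da x).hasFDerivAt).fderiv
  unfold pd
  change fderiv ℝ (G ∘ f) x _ = _
  rw [h]; simp

lemma pd_pd {f : E2 → ℝ} (hf : Sm f) (i j : Fin 2) (x : E2) :
    pd i (pd j f) x = fderiv ℝ (fderiv ℝ f) x (EuclideanSpace.basisFun (Fin 2) ℝ i)
      (EuclideanSpace.basisFun (Fin 2) ℝ j) := by
  have h : ContDiff ℝ (⊤ : ℕ∞) (fderiv ℝ f) := hf.fderiv_right (by simp)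
  have h2 : DifferentiableAt ℝ (fderiv ℝ f) x := (h.differentiable (by simp)) x
  unfold pd
  rw [fderiv_clm_apply h2 (differentiableAt_const _)]
  simp

lemma pd_comm {f : E2 → ℝ} (hf : Sm f) (i j : Fin 2) : pd i (pd j f) = pd j (pd i f) := by
  funext x
  rw [pd_pd hf, pd_pd hf]
  have : IsSymmSndFDerivAt ℝ f x := hf.contDiffAt.isSymmSndFDerivAt (by
    simp only [minSmoothness_of_isRCLikeNormedField]
    exact WithTop.coe_le_coe.mpr (le_top : (2 : ℕ∞) ≤ ⊤))
  exact this _ _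

lemma hess_eq {u : E2 → ℝ} (hu : Sm u) (x : E2) (i j : Fin 2) :
    hessian u x i j = pd i (pd j u) x := by
  rw [pd_pd hu]
  simp [hessian, iteratedFDeriv_two_apply]

lemma pd_coord (i j : Fin 2) : pd i (fun x => x j) = fun _ => if i = j then 1 else 0 := by
  funext x
  have : (fun x : E2 => x j) = fun x => (EuclideanSpace.proj j : E2 →L[ℝ] ℝ) x := rfl
  unfold pd
  rw [this, ContinuousLinearMap.fderiv]
  fin_cases i <;> fin_cases j <;> simp

lemma sm_coord (j : Fin 2) : Sm (fun x => x j) :=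
  (EuclideanSpace.proj j : E2 →L[ℝ] ℝ).contDiff

lemma pd_line {f : E2 → ℝ} (hf : Sm f) (i : Fin 2) (z : E2) (t : ℝ) :
    HasDerivAt (fun t : ℝ => f (z + t • EuclideanSpace.basisFun (Fin 2) ℝ i))
      (pd i f (z + t • EuclideanSpace.basisFun (Fin 2) ℝ i)) t := by
  have h1 : HasDerivAt (fun t : ℝ => z + t • EuclideanSpace.basisFun (Fin 2) ℝ i)
      (EuclideanSpace.basisFun (Fin 2) ℝ i) t := by
    simpa using ((hasDerivAt_id t).smul_const (EuclideanSpace.basisFun (Fin 2) ℝ i)).const_add z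
  exact (hf.da _).hasFDerivAt.comp_hasDerivAt t h1

lemma min_first {f : E2 → ℝ} {z : E2} (h : IsLocalMin f z) (i : Fin 2) : pd i f z = 0 := by
  unfold pd
  rw [h.fderiv_eq_zero]; rfl

lemma min_second {f : E2 → ℝ} (hf : Sm f) {z : E2} (h : IsLocalMin f z) (i : Fin 2) :
    0 ≤ pd i (pd i f) z := by
  by_contra hn
  push Not at hn
  set e := EuclideanSpace.basisFun (Fin 2) ℝ i
  set g : ℝ → ℝ := fun t => f (z + t • e) with hg
  have d1 : deriv g = fun t => pd i f (z + t • e) := by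
    funext t; exact (pd_line hf i z t).deriv
  have d2 : deriv (deriv g) 0 = pd i (pd i f) z := by
    rw [d1]
    have := (pd_line (hf.pd i) i z 0).deriv
    rw [zero_smul, add_zero] at this
    exact this
  have hc : Continuous (fun t : ℝ => z + t • e) := by fun_prop
  have hmin : IsLocalMin g 0 := by
    have h' : ∀ᶠ x in nhds (z + (0:ℝ) • e), f z ≤ f x := by
      rw [zero_smul, add_zero]; exact h
    have := hc.continuousAt.eventually h'
    filter_upwards [this] with t ht
    simpa [hg] using ht
  have hcg : ContinuousAt g 0 := (pd_line hf i z 0).continuousAt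
  have hmax : IsLocalMax g 0 := by
    apply isLocalMax_of_deriv_deriv_neg _ _ hcg
    · rw [d2]; exact hn
    · exact hmin.deriv_eq_zero
  have heq : g =ᶠ[nhds 0] fun _ => g 0 := by
    filter_upwards [hmin, hmax] with t h1 h2
    exact le_antisymm h2 h1
  have h3 : deriv (deriv g) 0 = 0 := by
    rw [heq.deriv.deriv_eq]; simp
  linarith

lemma key_alg (a b c s t u1 u2 g g1 g2 : ℝ) (hg : a + c = g) (hgp : 0 < g)
    (hφ : 0 ≤ a * c - b * b) (hD : 0 < (a - c)^2 + 4 * b^2)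
    (h2 : g * g2 ≤ 2 * g1 ^ 2) (p q : ℝ)
    (hp : p = a * s + c * (g1 * u1 - s) - 2 * b * t)
    (hq : q = a * (g1 * u2 - t) + c * t - 2 * b * s) :
    2 * g1 * (a * c - b * b) + g2 * (c * u1^2 - 2 * b * u1 * u2 + a * u2^2)
      + 2 * (g1 * u1 * s + g1 * u2 * t) - 4 * (s^2 + t^2) ≤
    2 * g1 * (a * c - b * b) +
      (2 * (g1 * u1 * (a - c) - g1 * u2 * (2 * b)) + 8 * c * (g1 * u1)) / ((a - c)^2 + 4 * b^2) * p
      + (2 * (- (g1 * u1 * (2 * b)) - g1 * u2 * (a - c)) + 8 * a * (g1 * u2))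
        / ((a - c)^2 + 4 * b^2) * q := by
  set D := (a - c)^2 + 4 * b^2 with hDdef
  set Q := c * u1^2 - 2 * b * u1 * u2 + a * u2^2 with hQ
  have hQ0 : 0 ≤ Q := by
    have : g * Q = (a * c - b * b) * (u1^2 + u2^2) + (a * u2 - b * u1)^2 + (c * u1 - b * u2)^2 := by
      rw [hQ, ← hg]; ring
    have h : 0 ≤ g * Q := by rw [this]; positivity
    exact nonneg_of_mul_nonneg_right h hgp
  have hDg : D ≤ g^2 := by rw [hDdef, ← hg]; nlinarith
  have hid : D * (2 * (g1 * u1 * s + g1 * u2 * t) - 4 * (s^2 + t^2)) =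
      -2 * g * g1^2 * Q + (2 * (g1 * u1 * (a - c) - g1 * u2 * (2 * b)) + 8 * c * (g1 * u1)) * p
      + (2 * (- (g1 * u1 * (2 * b)) - g1 * u2 * (a - c)) + 8 * a * (g1 * u2)) * q
      - 4 * (p^2 + q^2) := by
    rw [hp, hq, hQ, hDdef, ← hg]; ring
  have h3 : D * g2 ≤ 2 * g * g1^2 := by
    by_cases hs : g2 ≤ 0
    · have : D * g2 ≤ 0 := mul_nonpos_of_nonneg_of_nonpos hD.le hs
      have : 0 ≤ 2 * g * g1^2 := by positivity
      linarith
    · push Not at hs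
      calc D * g2 ≤ g^2 * g2 := by gcongr
        _ = g * (g * g2) := by ring
        _ ≤ g * (2 * g1^2) := by gcongr
        _ = _ := by ring
  have h4 : D * g2 * Q ≤ 2 * g * g1^2 * Q := by gcongr
  have h5 : g2 * Q + (2 * (g1 * u1 * s + g1 * u2 * t) - 4 * (s^2 + t^2)) ≤
    ((2 * (g1 * u1 * (a - c) - g1 * u2 * (2 * b)) + 8 * c * (g1 * u1)) * p
      + (2 * (- (g1 * u1 * (2 * b)) - g1 * u2 * (a - c)) + 8 * a * (g1 * u2)) * q) / D := by
    rw [le_div_iff₀ hD]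
    nlinarith [sq_nonneg p, sq_nonneg q]
  have h6 := add_div ((2 * (g1 * u1 * (a - c) - g1 * u2 * (2 * b)) + 8 * c * (g1 * u1)) * p)
      ((2 * (- (g1 * u1 * (2 * b)) - g1 * u2 * (a - c)) + 8 * a * (g1 * u2)) * q) D
  rw [h6] at h5
  rw [div_mul_eq_mul_div, div_mul_eq_mul_div]
  linarith

/-- the barrier -/
noncomputable def bar (k : ℝ) (o : E2) (x : E2) : ℝ :=
  Real.exp (-k * ((x 0 - o 0) * (x 0 - o 0) + (x 1 - o 1) * (x 1 - o 1)))

lemma sm_sub (o : E2) (j : Fin 2) : Sm (fun x => x j - o j) := (sm_coord j).sub contDiff_const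

lemma sm_bar (k : ℝ) (o : E2) : Sm (bar k o) := by
  unfold bar
  have h0 := sm_sub o 0
  have h1 := sm_sub o 1
  exact (contDiff_const.mul ((h0.mul h0).add (h1.mul h1))).exp

lemma pd_csub (o : E2) (i j : Fin 2) :
    pd i (fun x => x j - o j) = fun _ => if i = j then 1 else 0 := by
  rw [pd_sub (sm_coord j) contDiff_const, pd_coord, pd_const]; simp

lemma pd_bar (k : ℝ) (o : E2) (i : Fin 2) :
    pd i (bar k o) = fun x => bar k o x * (-2 * k * (x i - o i)) := by
  have h0 := sm_sub o 0
  have h1 := sm_sub o 1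
  have h2 : Sm (fun x : E2 => (x 0 - o 0) * (x 0 - o 0)) := h0.mul h0
  have h3 : Sm (fun x : E2 => (x 1 - o 1) * (x 1 - o 1)) := h1.mul h1
  have h4 : Sm (fun x : E2 => (x 0 - o 0) * (x 0 - o 0) + (x 1 - o 1) * (x 1 - o 1)) := h2.add h3
  have h5 : Sm (fun x : E2 => -k * ((x 0 - o 0) * (x 0 - o 0) + (x 1 - o 1) * (x 1 - o 1))) :=
    contDiff_const.mul h4
  unfold bar
  rw [pd_comp Real.differentiable_exp h5, pd_mul contDiff_const h4, pd_add h2 h3,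
    pd_mul h0 h0, pd_mul h1 h1, pd_csub, pd_csub, pd_const]
  funext x
  fin_cases i <;> simp <;> ring

lemma pd_pd_bar (k : ℝ) (o : E2) (i : Fin 2) :
    pd i (pd i (bar k o)) =
      fun x => bar k o x * (4 * k^2 * (x i - o i)^2 - 2 * k) := by
  have h := sm_sub o i
  have h5 : Sm (fun x : E2 => -2 * k * (x i - o i)) := contDiff_const.mul h
  rw [pd_bar, pd_mul (sm_bar k o) h5, pd_mul contDiff_const h, pd_bar, pd_csub, pd_const]
  funext x
  simp; ring

lemma nsq (x : E2) : ‖x‖^2 = x 0 ^2 + x 1 ^2 := by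
  rw [EuclideanSpace.norm_sq_eq]; simp

set_option maxHeartbeats 1000000 in
lemma hopf {φ : E2 → ℝ} (hφ : Sm φ) (h0 : ∀ x, 0 ≤ φ x)
    (hL : ∀ y, φ y = 0 → ∃ B1 B2 : E2 → ℝ, ContinuousAt B1 y ∧ ContinuousAt B2 y ∧
      ∀ᶠ x in nhds y, pd 0 (pd 0 φ) x + pd 1 (pd 1 φ) x ≤ B1 x * pd 0 φ x + B2 x * pd 1 φ x)
    (p : E2) (hp : φ p = 0) (x : E2) : φ x = 0 := by
  by_contra hx
  have hZc : IsClosed {z | φ z = 0} := isClosed_eq hφ.continuous continuous_const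
  obtain ⟨y, hy, hyd⟩ := hZc.exists_infDist_eq_dist ⟨p, hp⟩ x
  have hy : φ y = 0 := hy
  have hfar : ∀ z, φ z = 0 → dist x y ≤ dist x z := fun z hz => by
    rw [← hyd]; exact Metric.infDist_le_dist_of_mem hz
  have hxy : 0 < dist x y := dist_pos.mpr (by rintro rfl; exact hx hy)
  -- the small ball
  obtain ⟨o, ho⟩ : ∃ o : E2, ∀ i, o i = (x i + y i) / 2 :=
    ⟨(1/2 : ℝ) • (x + y), fun i => by simp; ring⟩
  set N : E2 → ℝ := fun z => (z 0 - o 0) * (z 0 - o 0) + (z 1 - o 1) * (z 1 - o 1) with hN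
  have dsq : ∀ z w : E2, dist z w ^ 2 = (z 0 - w 0)^2 + (z 1 - w 1)^2 := fun z w => by
    rw [dist_eq_norm, nsq]; simp
  have hNc : Continuous N := by
    have := (sm_sub o 0).continuous
    have := (sm_sub o 1).continuous
    simp only [hN]; fun_prop
  have hNy : 4 * N y = dist x y ^ 2 := by
    rw [dsq]; simp only [hN, ho]; ring
  have hNpos : 0 < N y := by nlinarith
  have htouch : ∀ z, N z ≤ N y → φ z = 0 → z = y := by
    intro z hz hz0
    have h1 := hfar z hz0
    have h2 : dist x y ^ 2 ≤ dist x z ^ 2 := by gcongr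
    rw [dsq, dsq] at h2
    simp only [hN, ho] at hz
    have h3 : (z 0 - y 0)^2 + (z 1 - y 1)^2 ≤ 0 := by nlinarith
    have h4 : dist z y ^ 2 ≤ 0 := by rw [dsq]; exact h3
    have h5 : dist z y = 0 := by nlinarith [dist_nonneg (x := z) (y := y)]
    exact dist_eq_zero.mp h5
  obtain ⟨B1, B2, c1, c2, hB⟩ := hL y hy
  set T := B1 y * (y 0 - o 0) + B2 y * (y 1 - o 1) with hT
  obtain ⟨k, hk, hk0⟩ : ∃ k : ℝ, 0 < 2 * k * N y - 2 + T ∧ 0 < k := by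
    refine ⟨(|T| + 3) / (2 * N y), ?_, by positivity⟩
    have : 2 * ((|T| + 3) / (2 * N y)) * N y = |T| + 3 := by field_simp
    rw [this]
    linarith [neg_abs_le T]
  have hev : ∀ᶠ z in nhds y, 0 < 2 * k * N z - 2 + (B1 z * (z 0 - o 0) + B2 z * (z 1 - o 1)) := by
    have e0 := (sm_sub o 0).continuous.continuousAt (x := y)
    have e1 := (sm_sub o 1).continuous.continuousAt (x := y)
    have : ContinuousAt (fun z => 2 * k * N z - 2 + (B1 z * (z 0 - o 0) + B2 z * (z 1 - o 1))) y :=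
      ((continuousAt_const.mul hNc.continuousAt).sub continuousAt_const).add
        ((c1.mul e0).add (c2.mul e1))
    exact this.eventually (lt_mem_nhds hk)
  obtain ⟨r, hr, hball⟩ := Metric.eventually_nhds_iff.mp (hB.and hev)
  -- smaller closed ball
  set ρ := r / 2 with hρ
  have hρ0 : 0 < ρ := by positivity
  set v := bar k o with hv
  have hvc : Continuous v := (sm_bar k o).continuous
  have hvle : ∀ z, N y < N z → v z < v y := by
    intro z hz
    simp only [hv, bar]
    apply Real.exp_lt_exp.mpr
    simp only [hN] at hz
    nlinarith
  -- choose ε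
  obtain ⟨ε, hε, hεs⟩ : ∃ ε > 0, ∀ z ∈ Metric.sphere y ρ, 0 < φ z - ε * (v z - v y) := by
    have hK : IsCompact (Metric.sphere y ρ ∩ {z | N z ≤ N y}) :=
      (isCompact_sphere y ρ).inter_right (isClosed_le hNc continuous_const)
    have hpos : ∀ z ∈ Metric.sphere y ρ ∩ {z | N z ≤ N y}, 0 < φ z := by
      rintro z ⟨hz1, hz2⟩
      apply lt_of_le_of_ne (h0 z)
      intro h
      have := htouch z hz2 h.symm
      subst this
      simp at hz1
      linarith
    have hv1 : ∀ z, v z ≤ 1 := by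
      intro z
      simp only [hv, bar]
      apply Real.exp_le_one_iff.mpr
      nlinarith [mul_self_nonneg (z 0 - o 0), mul_self_nonneg (z 1 - o 1),
        mul_nonneg hk0.le (mul_self_nonneg (z 0 - o 0)),
        mul_nonneg hk0.le (mul_self_nonneg (z 1 - o 1))]
    have hvy : 0 < v y := Real.exp_pos _
    obtain ⟨m, hm, hmle⟩ : ∃ m > 0, ∀ z ∈ Metric.sphere y ρ ∩ {z | N z ≤ N y}, m ≤ φ z := by
      rcases (Metric.sphere y ρ ∩ {z | N z ≤ N y}).eq_empty_or_nonempty with he | hne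
      · exact ⟨1, one_pos, by rw [he]; simp⟩
      · obtain ⟨w, hw, hwm⟩ := hK.exists_isMinOn hne hφ.continuous.continuousOn
        exact ⟨φ w, hpos w hw, fun z hz => hwm hz⟩
    refine ⟨m, hm, fun z hz => ?_⟩
    by_cases hzN : N z ≤ N y
    · have := hmle z ⟨hz, hzN⟩
      have := hv1 z
      nlinarith
    · push Not at hzN
      have := hvle z hzN
      have := h0 z
      nlinarith
  set ψ : E2 → ℝ := fun z => φ z - ε * v z with hψ
  have hevs : Sm (fun z => ε * v z) := contDiff_const.mul (sm_bar k o)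
  have hψs : Sm ψ := hφ.sub hevs
  obtain ⟨z, hz, hzm⟩ := (isCompact_closedBall y ρ).exists_isMinOn
    ⟨y, Metric.mem_closedBall_self hρ0.le⟩ hψs.continuous.continuousOn
  have hzy : ψ z ≤ ψ y := hzm (Metric.mem_closedBall_self hρ0.le)
  have hzb : z ∈ Metric.ball y ρ := by
    rw [Metric.mem_ball]
    apply lt_of_le_of_ne (Metric.mem_closedBall.mp hz)
    intro h
    have := hεs z h
    simp only [hψ, hy] at hzy
    linarith
  have hloc : IsLocalMin ψ z := by
    filter_upwards [Metric.isOpen_ball.mem_nhds hzb] with w hw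
    exact hzm (Metric.ball_subset_closedBall hw)
  have hpd : ∀ i, pd i ψ = fun w => pd i φ w - ε * pd i v w := by
    intro i
    rw [hψ, pd_sub hφ hevs, pd_mul contDiff_const (sm_bar k o), pd_const]
    simp [hv]
  have hpd2 : ∀ i, pd i (pd i ψ) z = pd i (pd i φ) z - ε * pd i (pd i v) z := by
    intro i
    have hs : Sm (fun w => ε * pd i v w) := contDiff_const.mul ((sm_bar k o).pd i)
    rw [hpd, pd_sub (hφ.pd i) hs, pd_mul contDiff_const ((sm_bar k o).pd i), pd_const]
    simp [hv]
  have f0 := min_first hloc 0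
  have f1 := min_first hloc 1
  have s0 := min_second hψs hloc 0
  have s1 := min_second hψs hloc 1
  rw [hpd] at f0 f1
  rw [hpd2] at s0 s1
  rw [hv, pd_pd_bar] at s0 s1
  rw [hv, pd_bar] at f0 f1
  have hzr : dist z y < r := by
    have := Metric.mem_ball.mp hzb
    linarith
  obtain ⟨g1, g2⟩ := hball hzr
  simp only at f0 f1 s0 s1
  have f0' : pd 0 φ z = ε * (bar k o z * (-2 * k * (z 0 - o 0))) := by linarith
  have f1' : pd 1 φ z = ε * (bar k o z * (-2 * k * (z 1 - o 1))) := by linarith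
  rw [f0', f1'] at g1
  have hb : 0 < bar k o z := Real.exp_pos _
  have hfin : 0 < (2 * k * ε * bar k o z) *
      (2 * k * N z - 2 + (B1 z * (z 0 - o 0) + B2 z * (z 1 - o 1))) := by positivity
  simp only [hN] at hfin
  clear * - hfin g1 s0 s1
  linarith

lemma lap_formula (G : ℝ → ℝ) (hG : ContDiff ℝ (⊤ : ℕ∞) G) (u : E2 → ℝ) (hu : Sm u)
    (heq : ∀ x, pd 0 (pd 0 u) x + pd 1 (pd 1 u) x = G (u x)) (φ : E2 → ℝ)
    (hφ : φ = fun x => pd 0 (pd 0 u) x * pd 1 (pd 1 u) x - pd 0 (pd 1 u) x * pd 0 (pd 1 u) x)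
    (x : E2) : ∃ s t : ℝ,
    pd 0 φ x = pd 0 (pd 0 u) x * s + pd 1 (pd 1 u) x * (deriv G (u x) * pd 0 u x - s)
      - 2 * pd 0 (pd 1 u) x * t ∧
    pd 1 φ x = pd 0 (pd 0 u) x * (deriv G (u x) * pd 1 u x - t) + pd 1 (pd 1 u) x * t
      - 2 * pd 0 (pd 1 u) x * s ∧
    pd 0 (pd 0 φ) x + pd 1 (pd 1 φ) x =
      2 * deriv G (u x) * (pd 0 (pd 0 u) x * pd 1 (pd 1 u) x - pd 0 (pd 1 u) x * pd 0 (pd 1 u) x)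
      + deriv (deriv G) (u x) * (pd 1 (pd 1 u) x * pd 0 u x ^ 2
        - 2 * pd 0 (pd 1 u) x * pd 0 u x * pd 1 u x + pd 0 (pd 0 u) x * pd 1 u x ^ 2)
      + 2 * (deriv G (u x) * pd 0 u x * s + deriv G (u x) * pd 1 u x * t) - 4 * (s^2 + t^2) := by
  have hGd : Differentiable ℝ G := hG.differentiable (by simp)
  have hG1 : ContDiff ℝ (⊤ : ℕ∞) (deriv G) := by
    have : ContDiff ℝ ((⊤ : ℕ∞) + 1) G := by simpa using hG
    exact (contDiff_succ_iff_deriv.mp this).2.2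
  have hG1d : Differentiable ℝ (deriv G) := hG1.differentiable (by simp)
  set a := pd 0 (pd 0 u) with ha
  set b := pd 0 (pd 1 u) with hb
  set c := pd 1 (pd 1 u) with hc
  have sa : Sm a := (hu.pd 0).pd 0
  have sb : Sm b := (hu.pd 1).pd 0
  have sc : Sm c := (hu.pd 1).pd 1
  have hb' : pd 1 (pd 0 u) = b := pd_comm hu 1 0
  have hac : (fun x => a x + c x) = fun x => G (u x) := funext heq
  have sG1 : Sm (fun x => deriv G (u x)) := hG1.comp hu
  -- third derivatives
  have hb0 : pd 0 b = pd 1 a := by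
    rw [ha, ← hb', pd_comm (hu.pd 0) 0 1]
  have hb1 : pd 1 b = pd 0 c := by
    rw [hb, hc, pd_comm (hu.pd 1) 0 1]
  have h1 : ∀ i, (fun x => pd i a x + pd i c x) = fun x => deriv G (u x) * pd i u x := by
    intro i
    rw [← pd_add sa sc, hac, pd_comp hGd hu]
  have h2 : ∀ i j, (fun x => pd j (pd i a) x + pd j (pd i c) x) =
      fun x => deriv G (u x) * pd j (pd i u) x + deriv (deriv G) (u x) * pd j u x * pd i u x := by
    intro i j
    rw [← pd_add (sa.pd i) (sc.pd i), h1, pd_mul sG1 (hu.pd i), pd_comp hG1d hu]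
  -- fourth derivatives
  have hca : pd 1 (pd 1 a) = pd 0 (pd 0 c) := by
    rw [← hb0, pd_comm sb 1 0, hb1]
  have hbb0 : pd 0 (pd 0 b) = pd 0 (pd 1 a) := by rw [hb0]
  have hbb1 : pd 1 (pd 1 b) = pd 0 (pd 1 c) := by rw [hb1, pd_comm sc 1 0]
  have e1 : ∀ i, pd i φ = fun x => (a x * pd i c x + pd i a x * c x)
      - (b x * pd i b x + pd i b x * b x) := by
    intro i
    rw [hφ, pd_sub (sa.mul sc) (sb.mul sb), pd_mul sa sc, pd_mul sb sb]
  have e2 : ∀ i, pd i (pd i φ) = fun x =>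
      ((a x * pd i (pd i c) x + pd i a x * pd i c x) + (pd i a x * pd i c x + pd i (pd i a) x * c x))
      - ((b x * pd i (pd i b) x + pd i b x * pd i b x)
        + (pd i b x * pd i b x + pd i (pd i b) x * b x)) := by
    intro i
    have m1 := sa.mul (sc.pd i)
    have m2 := (sa.pd i).mul sc
    have m3 := sb.mul (sb.pd i)
    have m4 := (sb.pd i).mul sb
    rw [e1, pd_sub (m1.add m2) (m3.add m4), pd_add m1 m2, pd_add m3 m4, pd_mul sa (sc.pd i),
      pd_mul (sa.pd i) sc, pd_mul sb (sb.pd i), pd_mul (sb.pd i) sb]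
  refine ⟨pd 0 c x, pd 1 a x, ?_, ?_, ?_⟩
  · have := congrFun (h1 0) x
    rw [e1, ← this, hb0]; ring
  · have := congrFun (h1 1) x
    rw [e1, ← this, hb1]; ring
  · have k0 := congrFun (h1 0) x
    have k1 := congrFun (h1 1) x
    have q00 := congrFun (h2 0 0) x
    have q11 := congrFun (h2 1 1) x
    have q10 := congrFun (h2 1 0) x
    rw [← ha] at q00
    rw [← hc, hca] at q11
    rw [← hb] at q10
    rw [e2, e2, hbb0, hbb1, hb0, hb1, hca, ← k0, ← k1]
    simp only
    linear_combination c x * q00 + a x * q11 - 2 * b x * q10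

/-- **Stronger constant rank theorem in the plane** (Theorem 1.2):
if `u` is a smooth convex solution of `Δu = G(u)` on `ℝ²`, with `G > 0`, `G' < 0`,
`G·G'' ≤ A·(G')²` for some constant `0 < A ≤ 2`, and `det (D²u)` attains a local
minimum somewhere, then `det (D²u) ≡ 0`. -/
theorem stmt_0 (G : ℝ → ℝ) (A : ℝ) (hApos : 0 < A) (hA2 : A ≤ 2)
    (hG : ContDiff ℝ (⊤ : ℕ∞) G)
    (hGpos : ∀ t, 0 < G t)
    (hG' : ∀ t, deriv G t < 0)
    (hGG'' : ∀ t, G t * deriv (deriv G) t ≤ A * (deriv G t) ^ 2)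
    (u : EuclideanSpace ℝ (Fin 2) → ℝ) (hu : ContDiff ℝ (⊤ : ℕ∞) u)
    (hconv : ∀ x, (hessian u x).PosSemidef)
    (heq : ∀ x, ∑ i, hessian u x i i = G (u x))
    (p : EuclideanSpace ℝ (Fin 2))
    (hmin : IsLocalMin (fun x => (hessian u x).det) p) :
    ∀ x, (hessian u x).det = 0 := by
  have hdet : (fun x => (hessian u x).det) =
      fun x => pd 0 (pd 0 u) x * pd 1 (pd 1 u) x - pd 0 (pd 1 u) x * pd 0 (pd 1 u) x := by
    funext x
    rw [Matrix.det_fin_two, hess_eq hu, hess_eq hu, hess_eq hu, hess_eq hu, pd_comm hu 1 0]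
  have heq' : ∀ x, pd 0 (pd 0 u) x + pd 1 (pd 1 u) x = G (u x) := by
    intro x
    rw [← heq x, Fin.sum_univ_two, hess_eq hu, hess_eq hu]
  have hnn : ∀ x, 0 ≤ (fun x => (hessian u x).det) x := fun x => (hconv x).det_nonneg
  set φ : E2 → ℝ := fun x => (hessian u x).det with hφ
  have sa : Sm (pd 0 (pd 0 u)) := (Sm.pd hu 0).pd 0
  have sb : Sm (pd 0 (pd 1 u)) := (Sm.pd hu 1).pd 0
  have sc : Sm (pd 1 (pd 1 u)) := (Sm.pd hu 1).pd 1
  have hs : Sm φ := by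
    rw [hdet]
    exact (sa.mul sc).sub (sb.mul sb)
  have hA : ∀ t, G t * deriv (deriv G) t ≤ 2 * (deriv G t) ^ 2 := fun t =>
    (hGG'' t).trans (by gcongr)
  have hform := lap_formula G hG u hu heq' φ hdet
  have hv : ∀ x, pd 0 (pd 0 u) x * pd 1 (pd 1 u) x - pd 0 (pd 1 u) x * pd 0 (pd 1 u) x = φ x :=
    fun x => (congrFun hdet x).symm
  have hDid : ∀ x, (pd 0 (pd 0 u) x - pd 1 (pd 1 u) x)^2 + 4 * pd 0 (pd 1 u) x ^ 2
      = G (u x)^2 - 4 * φ x := by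
    intro x
    rw [← hv x, ← heq' x]; ring
  -- the value at p
  have hp0 : φ p = 0 := by
    by_contra hne
    have hpos : 0 < φ p := lt_of_le_of_ne (hnn p) (Ne.symm hne)
    obtain ⟨s, t, h1, h2, h3⟩ := hform p
    have f0 := min_first hmin 0
    have f1 := min_first hmin 1
    have s0 := min_second hs hmin 0
    have s1 := min_second hs hmin 1
    have hneg : 2 * deriv G (u p) * φ p < 0 := by nlinarith [hG' (u p)]
    rcases (by positivity : 0 ≤ (pd 0 (pd 0 u) p - pd 1 (pd 1 u) p)^2
        + 4 * pd 0 (pd 1 u) p ^ 2).lt_or_eq with hD | hD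
    · have hk := key_alg _ _ _ s t (pd 0 u p) (pd 1 u p) _ (deriv G (u p)) _ (heq' p) (hGpos _)
        (by rw [hv]; exact hpos.le) hD (hA (u p)) _ _ h1 h2
      rw [← h3, f0, f1, hv] at hk
      linarith
    · have hb : pd 0 (pd 1 u) p = 0 := by
        nlinarith [sq_nonneg (pd 0 (pd 0 u) p - pd 1 (pd 1 u) p)]
      have hac : pd 0 (pd 0 u) p = pd 1 (pd 1 u) p := by
        rw [hb] at hD
        nlinarith
      have hg := heq' p
      have hgp := hGpos (u p)
      have hc : 0 < pd 1 (pd 1 u) p := by linarith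
      rw [f0, hb, hac] at h1
      rw [f1, hb, hac] at h2
      have z0 : pd 1 (pd 1 u) p * (deriv G (u p) * pd 0 u p) = 0 := by linarith
      have z1 : pd 1 (pd 1 u) p * (deriv G (u p) * pd 1 u p) = 0 := by linarith
      have y0 : pd 0 u p = 0 := by simpa [hc.ne', (hG' (u p)).ne] using z0
      have y1 : pd 1 u p = 0 := by simpa [hc.ne', (hG' (u p)).ne] using z1
      rw [hv, y0, y1] at h3
      nlinarith [sq_nonneg s, sq_nonneg t]
  refine hopf (φ := φ) hs hnn ?_ p hp0
  intro y hy
  have hy : φ y = 0 := hy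
  have hG1 : Continuous (deriv G) := hG.continuous_deriv (by simp)
  have ca := sa.continuous
  have cb := sb.continuous
  have cc := sc.continuous
  have c0 := (Sm.pd hu 0).continuous
  have c1 := (Sm.pd hu 1).continuous
  have cu := hu.continuous
  have cg : Continuous (fun x => deriv G (u x)) := hG1.comp cu
  have cD : Continuous (fun x => (pd 0 (pd 0 u) x - pd 1 (pd 1 u) x)^2 + 4 * pd 0 (pd 1 u) x ^ 2) := by
    fun_prop
  have hDy : 0 < (pd 0 (pd 0 u) y - pd 1 (pd 1 u) y)^2 + 4 * pd 0 (pd 1 u) y ^ 2 := by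
    rw [hDid, hy]
    have := hGpos (u y)
    simp; positivity
  refine ⟨fun x => (2 * (deriv G (u x) * pd 0 u x * (pd 0 (pd 0 u) x - pd 1 (pd 1 u) x)
      - deriv G (u x) * pd 1 u x * (2 * pd 0 (pd 1 u) x))
      + 8 * pd 1 (pd 1 u) x * (deriv G (u x) * pd 0 u x))
      / ((pd 0 (pd 0 u) x - pd 1 (pd 1 u) x)^2 + 4 * pd 0 (pd 1 u) x ^ 2),
    fun x => (2 * (- (deriv G (u x) * pd 0 u x * (2 * pd 0 (pd 1 u) x))
      - deriv G (u x) * pd 1 u x * (pd 0 (pd 0 u) x - pd 1 (pd 1 u) x))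
      + 8 * pd 0 (pd 0 u) x * (deriv G (u x) * pd 1 u x))
      / ((pd 0 (pd 0 u) x - pd 1 (pd 1 u) x)^2 + 4 * pd 0 (pd 1 u) x ^ 2), ?_, ?_, ?_⟩
  · exact ContinuousAt.div (Continuous.continuousAt (by fun_prop)) cD.continuousAt hDy.ne'
  · exact ContinuousAt.div (Continuous.continuousAt (by fun_prop)) cD.continuousAt hDy.ne'
  · filter_upwards [cD.continuousAt.eventually (lt_mem_nhds hDy)] with x hD
    obtain ⟨s, t, h1, h2, h3⟩ := hform x
    have hk := key_alg _ _ _ s t (pd 0 u x) (pd 1 u x) _ (deriv G (u x)) _ (heq' x) (hGpos _)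
        (by rw [hv]; exact hnn x) hD (hA (u x)) _ _ h1 h2
    rw [← h3, hv] at hk
    have hneg : 2 * deriv G (u x) * φ x ≤ 0 := by nlinarith [hG' (u x), hnn x]
    linarith
end

section
/- Let n ≥ 2, let Ω ⊆ ℝⁿ be an open connected set, let G : ℝ → ℝ be a smooth function satisfying G > 0, G' < 0 and G·G'' ≤ A·(G')² everywhere, where A is a constant with 0 < A ≤ 2, and let u : Ω → ℝ be a smooth convex solution of Δu = G(u) in Ω. If the function x ↦ σ₂(D²u(x)) attains a local minimum at an interior point of Ω, then the Hessian matrix D²u(x) has rank exactly 1 at every point x ∈ Ω. -/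
/-- The second elementary symmetric polynomial of the eigenvalues of a symmetric
matrix `M`, equivalently `σ₂(M) = ((tr M)² − Σᵢⱼ Mᵢⱼ²)/2`. -/
noncomputable def sigma2 {n : ℕ} (M : Matrix (Fin n) (Fin n) ℝ) : ℝ :=
  ((∑ i, M i i) ^ 2 - ∑ i, ∑ j, (M i j) ^ 2) / 2

open scoped Matrix Topology

theorem eig {n : ℕ} (H : Matrix (Fin n) (Fin n) ℝ) (hH : H.PosSemidef) :
  ∃ (l : Fin n → ℝ) (φ : (Fin n → ℝ) →ₗ[ℝ] (Fin n → ℝ)), (∀ i, 0 ≤ l i) ∧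
   (∀ a b, ∑ i, a i * b i = ∑ i, φ a i * φ b i) ∧ (∀ v i, φ (H *ᵥ v) i = l i * φ v i) ∧
   (∑ i, H i i = ∑ i, l i) ∧ (∑ i, ∑ j, H i j ^ 2 = ∑ i, l i ^ 2) ∧
   H.rank = Fintype.card {i // l i ≠ 0} := by
  have hh := hH.isHermitian
  set U : Matrix (Fin n) (Fin n) ℝ := (hh.eigenvectorUnitary).1 with hU
  have h1 : Uᵀ * U = 1 := by
    have := Unitary.coe_star_mul_self hh.eigenvectorUnitary
    simpa [Matrix.star_eq_conjTranspose] using this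
  have h2 : U * Uᵀ = 1 := mul_eq_one_comm.mp h1
  have h3 : H = U * Matrix.diagonal hh.eigenvalues * Uᵀ := by
    have := hh.spectral_theorem
    simpa [Unitary.conjStarAlgAut_apply, Matrix.star_eq_conjTranspose, Function.comp_def] using this
  have h4 : Uᵀ * H = Matrix.diagonal hh.eigenvalues * Uᵀ := by
    calc Uᵀ * H = Uᵀ * (U * Matrix.diagonal hh.eigenvalues * Uᵀ) := by rw [← h3]
      _ = (Uᵀ * U) * Matrix.diagonal hh.eigenvalues * Uᵀ := by simp only [Matrix.mul_assoc]
      _ = _ := by rw [h1, Matrix.one_mul]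
  refine ⟨hh.eigenvalues, Matrix.mulVecLin Uᵀ, hH.eigenvalues_nonneg, ?_, ?_, ?_, ?_, ?_⟩
  · intro a b
    change a ⬝ᵥ b = (Uᵀ *ᵥ a) ⬝ᵥ (Uᵀ *ᵥ b)
    rw [Matrix.dotProduct_mulVec, Matrix.vecMul_mulVec]
    simp [h2]
  · intro v i
    simp only [Matrix.mulVecLin_apply, Matrix.mulVec_mulVec, h4]
    rw [← Matrix.mulVec_mulVec, Matrix.mulVec_diagonal]
  · have := hh.trace_eq_sum_eigenvalues
    simpa [Matrix.trace] using this
  · have e1 : ∑ i, ∑ j, H i j ^ 2 = (H * H).trace := by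
      simp only [Matrix.trace, Matrix.diag, Matrix.mul_apply]
      refine Finset.sum_congr rfl fun i _ => Finset.sum_congr rfl fun j _ => ?_
      have : H j i = H i j := by simpa using hh.apply i j
      rw [this, sq]
    have e2 : H * H = U * (Matrix.diagonal hh.eigenvalues * (Uᵀ * H)) := by
      rw [← Matrix.mul_assoc, ← Matrix.mul_assoc, ← h3]
    rw [e1, e2, h4, ← Matrix.mul_assoc, ← Matrix.mul_assoc, Matrix.trace_mul_comm,
       ← Matrix.mul_assoc,← Matrix.mul_assoc, h1]
    simp [Matrix.trace, sq]
  · exact hh.rank_eq_card_non_zero_eigs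

theorem sum_sq_le_sq {n : ℕ} (s : Finset (Fin n)) (l : Fin n → ℝ) (hl : ∀ i, 0 ≤ l i) :
    ∑ j ∈ s, l j ^ 2 ≤ (∑ j ∈ s, l j) ^ 2 := by
  rw [sq (∑ j ∈ s, l j), Finset.sum_mul]
  refine Finset.sum_le_sum fun i hi => ?_
  rw [sq]
  exact mul_le_mul_of_nonneg_left (Finset.single_le_sum (fun j _ => hl j) hi) (hl i)

theorem sum_sq_le' {n : ℕ} (l : Fin n → ℝ) (hl : ∀ i, 0 ≤ l i) (i : Fin n) :
    ∑ j, l j ^ 2 ≤ l i ^ 2 + ((∑ j, l j) - l i) ^ 2 := by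
  have a := Finset.add_sum_erase Finset.univ (fun j => l j ^ 2) (Finset.mem_univ i)
  have b := Finset.add_sum_erase Finset.univ (fun j => l j) (Finset.mem_univ i)
  have c := sum_sq_le_sq (Finset.univ.erase i) l hl
  rw [← a, ← b]; simp only [add_sub_cancel_left]; linarith

theorem le_sum' {n : ℕ} (l : Fin n → ℝ) (hl : ∀ i, 0 ≤ l i) (i : Fin n) :
    l i ≤ ∑ j, l j := Finset.single_le_sum (fun j _ => hl j) (Finset.mem_univ i)

theorem mat_a {n : ℕ} (H : Matrix (Fin n) (Fin n) ℝ) (hH : H.PosSemidef) :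
    0 ≤ sigma2 H := by
  obtain ⟨l, φ, h0, h1, h2, h3, h4, h5⟩ := eig H hH
  have := sum_sq_le_sq Finset.univ l h0
  rw [sigma2, h3, h4]; linarith

theorem mat_b {n : ℕ} (H : Matrix (Fin n) (Fin n) ℝ) (hH : H.PosSemidef) (q : Fin n → ℝ) :
    ∑ i, q i * (H *ᵥ q) i ≤ (∑ i, H i i) * ∑ i, q i * q i := by
  obtain ⟨l, φ, h0, h1, h2, h3, h4, h5⟩ := eig H hH
  rw [h1 q (H *ᵥ q), h1 q q, h3, Finset.mul_sum]
  refine Finset.sum_le_sum fun i _ => ?_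
  rw [h2]
  nlinarith [le_sum' l h0 i, mul_self_nonneg (φ q i)]

theorem mat_c {n : ℕ} (H : Matrix (Fin n) (Fin n) ℝ) (hH : H.PosSemidef) (g : ℝ) (hg : 0 < g)
    (htr : ∑ i, H i i = g) (q y : Fin n → ℝ) (hy : y = (3:ℝ) • q - (2 / g) • (H *ᵥ q)) :
    (∑ i, ∑ j, H i j ^ 2) * (∑ i, y i * y i) + 2 * ∑ i, (H *ᵥ y) i * (H *ᵥ y) i
      ≤ 3 * g ^ 2 * ∑ i, q i * y i := by
  obtain ⟨l, φ, h0, h1, h2, h3, h4, h5⟩ := eig H hH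
  rw [h1 y y, h1 (H *ᵥ y), h1 q y, h4, Finset.mul_sum, Finset.mul_sum, Finset.mul_sum, ← Finset.sum_add_distrib]
  refine Finset.sum_le_sum fun i _ => ?_
  have hyi : φ y i = (3 - 2 / g * l i) * φ q i := by
    rw [hy]; simp [h2]; ring
  rw [h2, hyi]
  have hN := sum_sq_le' l h0 i
  have hl := le_sum' l h0 i
  rw [← h3, htr] at hN hl
  have hli := h0 i
  generalize ∑ j, l j ^ 2 = N at *
  generalize l i = t at *
  obtain ⟨s, rfl⟩ : ∃ s, t = g * s := ⟨t / g, by field_simp⟩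
  have e : 2 / g * (g * s) = 2 * s := by field_simp
  rw [e]
  have hs0 : 0 ≤ s := by nlinarith
  have hs1 : s ≤ 1 := by nlinarith
  have k1 : (N + 2 * (g * s) ^ 2) * (3 - 2 * s) ≤ 3 * g ^ 2 := by
    have : (N + 2 * (g * s) ^ 2) * (3 - 2 * s) ≤
      ((g * s) ^ 2 + (g - g * s) ^ 2 + 2 * (g * s) ^ 2) * (3 - 2 * s) := by
      apply mul_le_mul_of_nonneg_right <;> linarith
    have h8 : 0 ≤ 8 * s * (1 - s) ^ 2 * g ^ 2 := by positivity
    nlinarith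
  have k2 : 0 ≤ (3 - 2 * s) * φ q i ^ 2 := mul_nonneg (by linarith) (sq_nonneg _)
  nlinarith [mul_le_mul_of_nonneg_right k1 k2]

theorem mat_rank {n : ℕ} (H : Matrix (Fin n) (Fin n) ℝ) (hH : H.PosSemidef)
    (htr : 0 < ∑ i, H i i) (hs : sigma2 H = 0) : H.rank = 1 := by
  obtain ⟨l, φ, h0, h1, h2, h3, h4, h5⟩ := eig H hH
  rw [h5]
  rw [sigma2, h4, h3] at hs
  rw [h3] at htr
  obtain ⟨i, hi⟩ : ∃ i, l i ≠ 0 := by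
    by_contra! h
    simp [h] at htr
  have hi0 : 0 < l i := lt_of_le_of_ne (h0 i) (Ne.symm hi)
  rw [Fintype.card_eq_one_iff]
  refine ⟨⟨i, hi⟩, ?_⟩
  rintro ⟨j, hj⟩
  by_contra hne
  have hij : j ≠ i := fun h => hne (Subtype.ext h)
  have hN := sum_sq_le' l h0 i
  have hj0 : 0 < l j := lt_of_le_of_ne (h0 j) (Ne.symm hj)
  have : l i + l j ≤ ∑ k, l k := by
    rw [← Finset.sum_pair hij.symm]
    exact Finset.sum_le_sum_of_subset_of_nonneg (Finset.subset_univ _) (fun k _ _ => h0 k)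
  nlinarith

theorem tensor {n : ℕ} (T : Fin n → Fin n → Fin n → ℝ) (h1 : ∀ i j k, T i j k = T j i k)
    (h2 : ∀ i j k, T i j k = T i k j) (H : Matrix (Fin n) (Fin n) ℝ) (hH : ∀ i j, H i j = H j i)
    (y : Fin n → ℝ) :
    2 * ∑ k, y k * ∑ i, ∑ j, H i j * T k i j -
      ((∑ i, ∑ j, H i j ^ 2) * (∑ i, y i * y i) + 2 * ∑ i, (H *ᵥ y) i * (H *ᵥ y) i) / 3
    ≤ ∑ k, ∑ i, ∑ j, T k i j ^ 2 := by
  have h0 : 0 ≤ ∑ k, ∑ i, ∑ j, (T k i j - (H i j * y k + H k j * y i + H k i * y j) / 3) ^ 2 :=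
    Finset.sum_nonneg fun k _ => Finset.sum_nonneg fun i _ => Finset.sum_nonneg fun j _ => sq_nonneg _
  set X := ∑ k, ∑ i, ∑ j, y k * H i j * T k i j with hX
  have x1 : ∑ k, ∑ i, ∑ j, y i * H k j * T k i j = X := by
    rw [Finset.sum_comm]
    refine Finset.sum_congr rfl fun i _ => Finset.sum_congr rfl fun k _ => Finset.sum_congr rfl fun j _ => ?_
    rw [h1]
  have x2 : ∑ k, ∑ i, ∑ j, y j * H k i * T k i j = X := by
    rw [← x1]
    refine Finset.sum_congr rfl fun k _ => ?_
    rw [Finset.sum_comm]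
    refine Finset.sum_congr rfl fun i _ => Finset.sum_congr rfl fun j _ => ?_
    rw [h2]
  set Y := ∑ k, ∑ i, ∑ j, y k ^ 2 * H i j ^ 2 with hY
  have y1 : ∑ k, ∑ i, ∑ j, y i ^ 2 * H k j ^ 2 = Y := by
    rw [Finset.sum_comm]
  have y2 : ∑ k, ∑ i, ∑ j, y j ^ 2 * H k i ^ 2 = Y := by
    rw [← y1]
    refine Finset.sum_congr rfl fun k _ => ?_
    rw [Finset.sum_comm]
  set Z := ∑ k, ∑ i, ∑ j, (H k i * y i) * (H k j * y j) with hZ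
  have z1 : ∑ k, ∑ i, ∑ j, (H i j * y j) * (H i k * y k) = Z := by
    rw [Finset.sum_comm]
    refine Finset.sum_congr rfl fun k _ => ?_
    rw [Finset.sum_comm]
  have z2 : ∑ k, ∑ i, ∑ j, (H j i * y i) * (H j k * y k) = Z := by
    calc _ = ∑ k, ∑ j, ∑ i, (H j i * y i) * (H j k * y k) :=
          Finset.sum_congr rfl fun k _ => Finset.sum_comm
      _ = ∑ j, ∑ k, ∑ i, (H j i * y i) * (H j k * y k) := Finset.sum_comm
      _ = Z := Finset.sum_congr rfl fun j _ => Finset.sum_comm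
  have eX : ∑ k, y k * ∑ i, ∑ j, H i j * T k i j = X := by
    simp only [Finset.mul_sum, hX, mul_assoc]
  have eY : (∑ i, ∑ j, H i j ^ 2) * (∑ i, y i * y i) = Y := by
    rw [mul_comm, Finset.sum_mul]
    simp only [Finset.mul_sum, hY, sq]
  have eZ : ∑ i, (H *ᵥ y) i * (H *ᵥ y) i = Z := by
    simp only [Matrix.mulVec, dotProduct, Finset.sum_mul_sum, hZ]
  rw [eX, eY, eZ]
  have key : ∑ k, ∑ i, ∑ j, (T k i j - (H i j * y k + H k j * y i + H k i * y j) / 3) ^ 2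
     = (∑ k, ∑ i, ∑ j, T k i j ^ 2) - 2 / 3 * (X + X + X) + 1 / 9 * (Y + Y + Y) + 2 / 9 * (Z + Z + Z) := by
    nth_rewrite 3 [← x2]
    nth_rewrite 2 [← x1]
    nth_rewrite 3 [← y2]
    nth_rewrite 2 [← y1]
    nth_rewrite 3 [← z2]
    nth_rewrite 2 [← z1]
    rw [hX, hY, hZ]
    simp only [Finset.mul_sum, ← Finset.sum_add_distrib, ← Finset.sum_sub_distrib]
    refine Finset.sum_congr rfl fun k _ => Finset.sum_congr rfl fun i _ => Finset.sum_congr rfl fun j _ => ?_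
    rw [hH i k, hH j i, hH j k]
    ring
  rw [key] at h0
  linarith

theorem second_test {E : Type*} [NormedAddCommGroup E] [NormedSpace ℝ E] (f g : E → ℝ) (e x : E) (c : ℝ)
    (h1 : ∀ᶠ y in 𝓝 x, HasLineDerivAt ℝ f (g y) y e) (h2 : HasLineDerivAt ℝ g c x e)
    (hmin : IsLocalMin f x) : g x = 0 ∧ 0 ≤ c := by
  have hc : Filter.Tendsto (fun t : ℝ => x + t • e) (𝓝 0) (𝓝 x) := by
    have : Continuous (fun t : ℝ => x + t • e) := by fun_prop
    simpa using this.tendsto 0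
  set φ : ℝ → ℝ := fun t => f (x + t • e) with hφ
  have hm : IsLocalMin φ 0 := by
    have := hc.eventually hmin
    simpa [IsLocalMin, IsMinFilter, hφ] using this
  have hd : ∀ᶠ t in 𝓝 (0:ℝ), HasDerivAt φ (g (x + t • e)) t := by
    filter_upwards [hc.eventually h1] with t ht
    have ht' : HasDerivAt (fun s => f (x + t • e + s • e)) (g (x + t • e)) (t - t) := by
      simpa [HasLineDerivAt] using ht
    have := ht'.comp_sub_const t t
    refine this.congr_of_eventuallyEq (Filter.Eventually.of_forall fun s => ?_)
    simp only [hφ]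
    congr 1
    module
  have hd0 : HasDerivAt φ (g x) 0 := by simpa using hd.self_of_nhds
  have hg0 : g x = 0 := hm.hasDerivAt_eq_zero hd0
  refine ⟨hg0, ?_⟩
  by_contra! hneg
  have hderiv : deriv φ =ᶠ[𝓝 0] fun t => g (x + t • e) := by
    filter_upwards [hd] with t ht using ht.deriv
  have hdd : HasDerivAt (deriv φ) c 0 := HasDerivAt.congr_of_eventuallyEq h2 hderiv
  have hmax : IsLocalMax φ 0 := isLocalMax_of_deriv_deriv_neg (by rw [hdd.deriv]; exact hneg)
    (by rw [hd0.deriv, hg0]) hd0.continuousAt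
  have hconst : φ =ᶠ[𝓝 0] fun _ => φ 0 := by
    filter_upwards [hm, hmax] with t h1 h2 using le_antisymm h2 h1
  have h0 : deriv φ =ᶠ[𝓝 0] fun _ => 0 := by
    have := hconst.deriv
    simpa using this
  have : c = 0 := hdd.unique ((hasDerivAt_const (0:ℝ) (0:ℝ)).congr_of_eventuallyEq h0)
  linarith

section HL
variable {E : Type*} [NormedAddCommGroup E] [NormedSpace ℝ E] {f g : E → ℝ} {f' g' : ℝ} {x e : E}

theorem hl_mul (hf : HasLineDerivAt ℝ f f' x e) (hg : HasLineDerivAt ℝ g g' x e) :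
    HasLineDerivAt ℝ (fun x => f x * g x) (f' * g x + f x * g') x e := by
  unfold HasLineDerivAt at *
  simpa using hf.fun_mul hg

theorem hl_add (hf : HasLineDerivAt ℝ f f' x e) (hg : HasLineDerivAt ℝ g g' x e) :
    HasLineDerivAt ℝ (fun x => f x + g x) (f' + g') x e := by
  unfold HasLineDerivAt at *
  simpa using hf.fun_add hg

theorem hl_sub (hf : HasLineDerivAt ℝ f f' x e) (hg : HasLineDerivAt ℝ g g' x e) :
    HasLineDerivAt ℝ (fun x => f x - g x) (f' - g') x e := by
  unfold HasLineDerivAt at *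
  simpa using hf.fun_sub hg

theorem hl_const (c : ℝ) : HasLineDerivAt ℝ (fun _ : E => c) 0 x e := by
  unfold HasLineDerivAt
  exact hasDerivAt_const _ _

theorem hl_sum {ι : Type*} (s : Finset ι) {F : ι → E → ℝ} {F' : ι → ℝ}
    (h : ∀ i ∈ s, HasLineDerivAt ℝ (F i) (F' i) x e) :
    HasLineDerivAt ℝ (fun x => ∑ i ∈ s, F i x) (∑ i ∈ s, F' i) x e := by
  unfold HasLineDerivAt at *
  exact HasDerivAt.fun_sum h

theorem hl_comp {G : ℝ → ℝ} {c : ℝ} (hG : HasDerivAt G c (f x)) (hf : HasLineDerivAt ℝ f f' x e) :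
    HasLineDerivAt ℝ (fun x => G (f x)) (c * f') x e := by
  unfold HasLineDerivAt at *
  refine HasDerivAt.comp (h₂ := G) (h := fun t : ℝ => f (x + t • e)) 0 ?_ hf
  simpa using hG

theorem hl_congr (hf : HasLineDerivAt ℝ f f' x e) (h : f =ᶠ[𝓝 x] g) (h' : f' = g') :
    HasLineDerivAt ℝ g g' x e := by
  subst h'
  exact HasLineDerivAt.congr_of_eventuallyEq hf h.symm
end HL

set_option maxHeartbeats 1000000 in
theorem strong_min {n : ℕ} (Ω : Set (EuclideanSpace ℝ (Fin n))) (hO : IsOpen Ω) (hC : IsConnected Ω)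
    (S : EuclideanSpace ℝ (Fin n) → ℝ) (S1 S2 b : Fin n → EuclideanSpace ℝ (Fin n) → ℝ)
    (hS : ContinuousOn S Ω)
    (h1 : ∀ k, ∀ x ∈ Ω, HasLineDerivAt ℝ S (S1 k x) x (EuclideanSpace.basisFun (Fin n) ℝ k))
    (h2 : ∀ k, ∀ x ∈ Ω, HasLineDerivAt ℝ (S1 k) (S2 k x) x (EuclideanSpace.basisFun (Fin n) ℝ k))
    (hb : ∀ k, ContinuousOn (b k) Ω)
    (hL : ∀ x ∈ Ω, ∑ k, S2 k x ≤ ∑ k, b k x * S1 k x)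
    (hnn : ∀ x ∈ Ω, 0 ≤ S x) (p : EuclideanSpace ℝ (Fin n)) (hp : p ∈ Ω) (hSp : S p = 0) :
    ∀ x ∈ Ω, S x = 0 := by
  set Z : Set (EuclideanSpace ℝ (Fin n)) := {x | x ∈ Ω ∧ S x = 0} with hZ
  suffices hZo : IsOpen Z by
    have hsub : Ω ⊆ Z := by
      refine hC.isPreconnected.subset_of_closure_inter_subset hZo ⟨p, hp, hp, hSp⟩ ?_
      rintro x ⟨hx, hxO⟩
      refine ⟨hxO, ?_⟩
      have hcx : ContinuousAt S x := hS.continuousAt (hO.mem_nhds hxO)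
      by_contra hne
      have hev : ∀ᶠ y in 𝓝 x, S y ≠ 0 := hcx.eventually_ne hne
      rw [mem_closure_iff_nhds] at hx
      obtain ⟨y, hy1, hy2⟩ := hx _ hev
      exact hy1 hy2.2
    exact fun x hx => (hsub hx).2
  rw [Metric.isOpen_iff]
  rintro z0 ⟨hz0, hSz0⟩
  obtain ⟨δ, hδ, hball⟩ := Metric.nhds_basis_closedBall.mem_iff.mp (hO.mem_nhds hz0)
  refine ⟨δ / 2, by positivity, ?_⟩
  intro y hy
  rw [Metric.mem_ball] at hy
  have hyΩ : y ∈ Ω := hball (by rw [Metric.mem_closedBall]; linarith)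
  refine ⟨hyΩ, ?_⟩
  by_contra hSy
  -- nearest zero
  set C : Set (EuclideanSpace ℝ (Fin n)) := Metric.closedBall z0 δ ∩ S ⁻¹' {0} with hCdef
  have hCc : IsCompact C := by
    refine (isCompact_closedBall z0 δ).of_isClosed_subset ?_ Set.inter_subset_left
    exact (hS.mono hball).preimage_isClosed_of_isClosed Metric.isClosed_closedBall isClosed_singleton
  obtain ⟨z, hzC, hzmin⟩ := hCc.exists_isMinOn (f := fun x => dist y x)
    ⟨z0, Metric.mem_closedBall_self hδ.le, hSz0⟩ (by fun_prop)
  have hmin : ∀ x ∈ C, dist y z ≤ dist y x := fun x hx => hzmin hx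
  have hSz : S z = 0 := hzC.2
  have hzΩ : z ∈ Ω := hball hzC.1
  have hyz : y ≠ z := by rintro rfl; exact hSy hSz
  have hR : 0 < dist y z := dist_pos.mpr hyz
  have hRz0 : dist y z ≤ dist y z0 := hmin z0 ⟨Metric.mem_closedBall_self hδ.le, hSz0⟩
  -- half ball
  set a : EuclideanSpace ℝ (Fin n) := (1 / 2 : ℝ) • (z - y) with ha
  set m : EuclideanSpace ℝ (Fin n) := y + a with hm
  have hza : z - m = a := by rw [hm, ha]; module
  have hna : ‖a‖ = dist y z / 2 := by
    rw [ha, norm_smul, dist_comm, dist_eq_norm]; norm_num; ring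
  have hapos : 0 < ‖a‖ := by rw [hna]; positivity
  have hin : ∀ x, ‖x - m‖ ≤ ‖a‖ → x ∈ Ω ∧ (S x = 0 → x = z) := by
    intro x hx
    have hxy : x - y = (x - m) + a := by rw [hm]; module
    have hd : dist y x ≤ dist y z := by
      rw [dist_comm, dist_eq_norm, hxy]
      have := norm_add_le (x - m) a
      linarith
    have hxB : x ∈ Metric.closedBall z0 δ := by
      rw [Metric.mem_closedBall]
      have := dist_triangle x y z0
      rw [dist_comm x y] at this
      linarith
    refine ⟨hball hxB, fun hSx => ?_⟩
    have h3 : dist y z ≤ dist y x := hmin x ⟨hxB, hSx⟩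
    have h4 : ‖(x - m) + a‖ = 2 * ‖a‖ := by
      rw [← hxy, ← dist_eq_norm, dist_comm, hna]; linarith
    have h5 := norm_add_sq_real (x - m) a
    have h6 := norm_sub_sq_real (x - m) a
    rw [h4] at h5
    have h7 : ‖x - m - a‖ ^ 2 ≤ 0 := by nlinarith [norm_nonneg (x - m)]
    have h8 : ‖x - m - a‖ = 0 := by nlinarith [norm_nonneg (x - m - a)]
    have h9 := norm_eq_zero.mp h8
    rw [← hza] at h9
    have : x - z = 0 := by rw [← h9]; module
    exact sub_eq_zero.mp this
  -- barrier
  set ρ : EuclideanSpace ℝ (Fin n) → ℝ := fun x => (∑ k, (x k - m k) ^ 2) - ‖a‖ ^ 2 with hρ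
  have hρn : ∀ x, ρ x = ‖x - m‖ ^ 2 - ‖a‖ ^ 2 := by
    intro x; simp [hρ, EuclideanSpace.norm_sq_eq]
  have hρz : ρ z = 0 := by rw [hρn, hza]; ring
  have hρc : Continuous ρ := by rw [hρ]; fun_prop
  set q : ℝ := ∑ k, b k z * (z k - m k) with hq
  obtain ⟨M, hM0, hM⟩ : ∃ M : ℝ, 0 < M ∧ 0 < -2 * n + 8 * M * ‖a‖ ^ 2 + 2 * q := by
    refine ⟨(2 * n + 2 * |q| + 1) / (8 * ‖a‖ ^ 2), by positivity, ?_⟩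
    have : 8 * ((2 * n + 2 * |q| + 1) / (8 * ‖a‖ ^ 2)) * ‖a‖ ^ 2 = 2 * n + 2 * |q| + 1 := by
      field_simp
    rw [this]
    linarith [neg_abs_le q]
  set w : EuclideanSpace ℝ (Fin n) → ℝ := fun x => -ρ x + M * ρ x ^ 2 with hw
  set w1 : Fin n → EuclideanSpace ℝ (Fin n) → ℝ :=
    fun k x => (-1 + 2 * M * ρ x) * (2 * (x k - m k)) with hw1
  set w2 : Fin n → EuclideanSpace ℝ (Fin n) → ℝ :=
    fun k x => (-1 + 2 * M * ρ x) * 2 + 2 * M * (2 * (x k - m k)) ^ 2 with hw2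
  have dcoord : ∀ (k i : Fin n) (x : EuclideanSpace ℝ (Fin n)),
      HasLineDerivAt ℝ (fun x : EuclideanSpace ℝ (Fin n) => x i - m i) (if i = k then 1 else 0) x
        (EuclideanSpace.basisFun (Fin n) ℝ k) := by
    intro k i x
    unfold HasLineDerivAt
    have : HasDerivAt (fun t : ℝ => (x i - m i) + t * (if i = k then 1 else 0))
        (1 * (if i = k then 1 else 0)) 0 :=
      ((hasDerivAt_id (0:ℝ)).mul_const _).const_add _
    rw [one_mul] at this
    refine this.congr_of_eventuallyEq (Filter.Eventually.of_forall fun t => ?_)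
    simp
    split_ifs <;> ring
  have dρ : ∀ k x, HasLineDerivAt ℝ ρ (2 * (x k - m k)) x (EuclideanSpace.basisFun (Fin n) ℝ k) := by
    intro k x
    have h := hl_sub (hl_sum Finset.univ (fun i _ => hl_mul (dcoord k i x) (dcoord k i x))) (hl_const (‖a‖ ^ 2))
    refine hl_congr h (Filter.Eventually.of_forall fun x => ?_) ?_
    · simp only [hρ, sq]
    · simp [Finset.sum_add_distrib]; ring
  have dw : ∀ k x, HasLineDerivAt ℝ w (w1 k x) x (EuclideanSpace.basisFun (Fin n) ℝ k) := by
    intro k x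
    have h := dρ k x
    refine hl_congr (hl_add (hl_mul (hl_const (-1)) h) (hl_mul (hl_const M) (hl_mul h h)))
      (Filter.Eventually.of_forall fun x => ?_) ?_
    · simp only [hw]; ring
    · simp only [hw1]; ring
  have dw1 : ∀ k x, HasLineDerivAt ℝ (w1 k) (w2 k x) x (EuclideanSpace.basisFun (Fin n) ℝ k) := by
    intro k x
    have h := dρ k x
    have h3 := dcoord k k x
    rw [if_pos rfl] at h3
    refine hl_congr (hl_mul (hl_add (hl_const (-1)) (hl_mul (hl_const (2 * M)) h)) (hl_mul (hl_const 2) h3))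
      (Filter.Eventually.of_forall fun x => ?_) ?_
    · simp only [hw1]
    · simp only [hw2]; ring
  -- neighbourhood
  have ev1 : ∀ᶠ x in 𝓝 z, x ∈ Ω := hO.mem_nhds hzΩ
  have ev2 : ∀ᶠ x in 𝓝 z, M * ρ x < 1 := by
    have : ContinuousAt (fun x => M * ρ x) z := by fun_prop
    exact this.eventually_lt continuousAt_const (by simp [hρz])
  have ev3 : ∀ᶠ x in 𝓝 z, 0 < ∑ k, (w2 k x - b k x * w1 k x) := by
    have hbc : ∀ k, ContinuousAt (b k) z := fun k => (hb k).continuousAt (hO.mem_nhds hzΩ)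
    have : ContinuousAt (fun x => ∑ k, (w2 k x - b k x * w1 k x)) z := by
      refine tendsto_finsetSum _ fun k _ => ?_
      have c1 : ContinuousAt (w1 k) z := by
        rw [hw1]; fun_prop
      have c2 : ContinuousAt (w2 k) z := by
        rw [hw2]; fun_prop
      exact c2.sub ((hbc k).mul c1)
    refine continuousAt_const.eventually_lt this ?_
    have e1 : ∑ k, (w2 k z - b k z * w1 k z) = -2 * n + 8 * M * ‖a‖ ^ 2 + 2 * q := by
      have : ‖a‖ ^ 2 = ∑ k, (z k - m k) ^ 2 := by
        have := hρz; simp only [hρ] at this; linarith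
      rw [this, hq, Finset.mul_sum, Finset.mul_sum]
      have e2 : (-2 * n : ℝ) = ∑ k : Fin n, (-2 : ℝ) := by simp; ring
      rw [e2, ← Finset.sum_add_distrib, ← Finset.sum_add_distrib]
      refine Finset.sum_congr rfl fun k _ => ?_
      simp only [hw1, hw2, hρz]; ring
    rw [e1]; exact hM
  obtain ⟨r, hr, hrb⟩ := Metric.nhds_basis_closedBall.mem_iff.mp (ev1.and (ev2.and ev3))
  -- epsilon
  have hAc : IsCompact (Metric.sphere z r ∩ Metric.closedBall m ‖a‖) :=
    (isCompact_sphere z r).inter_right Metric.isClosed_closedBall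
  have hcB : ∀ x, x ∈ Metric.closedBall m ‖a‖ → ‖x - m‖ ≤ ‖a‖ := fun x hx => by
    rwa [Metric.mem_closedBall, dist_eq_norm] at hx
  obtain ⟨μ, hμ, hμS⟩ := hAc.exists_forall_le' (f := S) (a := 0)
    (hS.mono fun x hx => (hin x (hcB x hx.2)).1) (by
      rintro x ⟨hx1, hx2⟩
      obtain ⟨i1, i2⟩ := hin x (hcB x hx2)
      refine lt_of_le_of_ne (hnn x i1) fun h => ?_
      have := i2 h.symm
      rw [this, Metric.mem_sphere, dist_self] at hx1
      linarith)
  set B : ℝ := ‖a‖ ^ 2 + M * (‖a‖ ^ 2) ^ 2 with hB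
  have hBpos : 0 < B := by positivity
  set ε : ℝ := μ / (2 * B) with hε
  have hεpos : 0 < ε := by positivity
  have hsph : ∀ x ∈ Metric.sphere z r, 0 < S x - ε * w x := by
    intro x hx
    obtain ⟨g1, g2, g3⟩ := hrb (Metric.sphere_subset_closedBall hx)
    by_cases hxm : ‖x - m‖ ≤ ‖a‖
    · have s1 := hμS x ⟨hx, by rwa [Metric.mem_closedBall, dist_eq_norm]⟩
      have hwB : w x ≤ B := by
        have r1 : ρ x ≤ 0 := by rw [hρn]; nlinarith [norm_nonneg (x - m)]
        have r2 : -‖a‖ ^ 2 ≤ ρ x := by rw [hρn]; nlinarith [sq_nonneg ‖x - m‖]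
        have r3 : ρ x ^ 2 ≤ (‖a‖ ^ 2) ^ 2 := by nlinarith
        simp only [hw, hB]; nlinarith
      have : ε * w x ≤ μ / 2 := by
        calc ε * w x ≤ ε * B := by gcongr
          _ = μ / 2 := by rw [hε]; field_simp
      linarith
    · have r1 : 0 < ρ x := by
        rw [hρn]; push Not at hxm; nlinarith
      have hw0 : w x < 0 := by simp only [hw]; nlinarith
      have := hnn x g1
      nlinarith
  have hFc : ContinuousOn (fun x => S x - ε * w x) (Metric.closedBall z r) := by
    refine (hS.mono fun x hx => (hrb hx).1).sub (Continuous.continuousOn ?_)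
    rw [hw]; fun_prop
  obtain ⟨x, hxK, hxmin⟩ := (isCompact_closedBall z r).exists_isMinOn
    ⟨z, Metric.mem_closedBall_self hr.le⟩ hFc
  have hx0 : S x - ε * w x ≤ 0 := by
    have h := hxmin (Metric.mem_closedBall_self hr.le)
    simp only [Set.mem_ofPred_eq] at h
    have : S z - ε * w z = 0 := by rw [hSz]; simp [hw, hρz]
    linarith
  have hxball : x ∈ Metric.ball z r := by
    rw [Metric.mem_ball]
    refine lt_of_le_of_ne hxK fun h => ?_
    have := hsph x h
    linarith
  have hloc : IsLocalMin (fun x => S x - ε * w x) x :=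
    hxmin.isLocalMin (Filter.mem_of_superset (Metric.isOpen_ball.mem_nhds hxball) Metric.ball_subset_closedBall)
  obtain ⟨g1, g2, g3⟩ := hrb hxK
  have ht : ∀ k, S1 k x - ε * w1 k x = 0 ∧ 0 ≤ S2 k x - ε * w2 k x := by
    intro k
    refine second_test (fun x => S x - ε * w x) (fun x => S1 k x - ε * w1 k x)
      (EuclideanSpace.basisFun (Fin n) ℝ k) x _ ?_ ?_ hloc
    · filter_upwards [hO.mem_nhds g1] with y hy
      exact hl_congr (hl_sub (h1 k y hy) (hl_mul (hl_const ε) (dw k y))) (Filter.Eventually.of_forall fun x => rfl) (by ring)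
    · exact hl_congr (hl_sub (h2 k x g1) (hl_mul (hl_const ε) (dw1 k x))) (Filter.Eventually.of_forall fun x => rfl) (by ring)
  have hsum : 0 ≤ ∑ k, (S2 k x - ε * w2 k x) := Finset.sum_nonneg fun k _ => (ht k).2
  have hLx := hL x g1
  have hS1 : ∑ k, b k x * S1 k x = ∑ k, ε * (b k x * w1 k x) := by
    refine Finset.sum_congr rfl fun k _ => ?_
    have : S1 k x = ε * w1 k x := by linarith [(ht k).1]
    rw [this]; ring
  rw [Finset.sum_sub_distrib, ← Finset.mul_sum] at hsum
  rw [hS1, ← Finset.mul_sum] at hLx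
  rw [Finset.sum_sub_distrib] at g3
  nlinarith

/-- partial derivative -/
noncomputable def Dp {n : ℕ} (i : Fin n) (f : EuclideanSpace ℝ (Fin n) → ℝ) :
    EuclideanSpace ℝ (Fin n) → ℝ :=
  fun x => fderiv ℝ f x (EuclideanSpace.basisFun (Fin n) ℝ i)

section DP
variable {n : ℕ} {Ω : Set (EuclideanSpace ℝ (Fin n))} {f g : EuclideanSpace ℝ (Fin n) → ℝ}

theorem Dp_smooth (hO : IsOpen Ω) (hf : ContDiffOn ℝ (⊤ : ℕ∞) f Ω) (i : Fin n) :
    ContDiffOn ℝ (⊤ : ℕ∞) (Dp i f) Ω := by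
  have h := hf.fderiv_of_isOpen hO (m := (⊤ : ℕ∞)) (by simp)
  exact h.clm_apply contDiffOn_const

theorem Dp_hl (hO : IsOpen Ω) (hf : ContDiffOn ℝ (⊤ : ℕ∞) f Ω) (i : Fin n)
    {x : EuclideanSpace ℝ (Fin n)} (hx : x ∈ Ω) :
    HasLineDerivAt ℝ f (Dp i f x) x (EuclideanSpace.basisFun (Fin n) ℝ i) := by
  have : DifferentiableAt ℝ f x := (hf.contDiffAt (hO.mem_nhds hx)).differentiableAt (by simp)
  exact this.hasFDerivAt.hasLineDerivAt _

theorem Dp_eq {f' : ℝ} (hO : IsOpen Ω) (hf : ContDiffOn ℝ (⊤ : ℕ∞) f Ω) (i : Fin n)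
    {x : EuclideanSpace ℝ (Fin n)} (hx : x ∈ Ω)
    (h : HasLineDerivAt ℝ f f' x (EuclideanSpace.basisFun (Fin n) ℝ i)) : Dp i f x = f' :=
  (Dp_hl hO hf i hx).unique h

theorem Dp_congr (hO : IsOpen Ω) (h : ∀ x ∈ Ω, f x = g x) (i : Fin n)
    {x : EuclideanSpace ℝ (Fin n)} (hx : x ∈ Ω) : Dp i f x = Dp i g x := by
  have : f =ᶠ[𝓝 x] g := by
    filter_upwards [hO.mem_nhds hx] with y hy using h y hy
  simp only [Dp, this.fderiv_eq]

theorem Dp_Dp (hO : IsOpen Ω) (hf : ContDiffOn ℝ (⊤ : ℕ∞) f Ω) (i j : Fin n)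
    {x : EuclideanSpace ℝ (Fin n)} (hx : x ∈ Ω) : Dp i (Dp j f) x =
    fderiv ℝ (fderiv ℝ f) x (EuclideanSpace.basisFun (Fin n) ℝ i) (EuclideanSpace.basisFun (Fin n) ℝ j) := by
  have h := hf.fderiv_of_isOpen hO (m := (⊤ : ℕ∞)) (by simp)
  have hd : DifferentiableAt ℝ (fderiv ℝ f) x := (h.contDiffAt (hO.mem_nhds hx)).differentiableAt (by simp)
  have h3 := hd.hasFDerivAt.clm_apply (hasFDerivAt_const (EuclideanSpace.basisFun (Fin n) ℝ j) x)
  unfold Dp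
  rw [h3.fderiv]
  simp

theorem Dp_comm (hO : IsOpen Ω) (hf : ContDiffOn ℝ (⊤ : ℕ∞) f Ω) (i j : Fin n)
    {x : EuclideanSpace ℝ (Fin n)} (hx : x ∈ Ω) : Dp i (Dp j f) x = Dp j (Dp i f) x := by
  rw [Dp_Dp hO hf i j hx, Dp_Dp hO hf j i hx]
  have := (hf.contDiffAt (hO.mem_nhds hx)).isSymmSndFDerivAt (by
    rw [minSmoothness_of_isRCLikeNormedField]
    exact WithTop.coe_le_coe.mpr le_top)
  exact this _ _

theorem hess_Dp (hO : IsOpen Ω) (hf : ContDiffOn ℝ (⊤ : ℕ∞) f Ω) (i j : Fin n)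
    {x : EuclideanSpace ℝ (Fin n)} (hx : x ∈ Ω) : hessian f x i j = Dp i (Dp j f) x := by
  rw [Dp_Dp hO hf i j hx]
  simp [hessian, iteratedFDeriv_two_apply]

end DP

theorem alg_final {n : ℕ} (T : Fin n → Fin n → Fin n → ℝ) (h1 : ∀ i j k, T i j k = T j i k)
    (h2 : ∀ i j k, T i j k = T i k j) (H : Matrix (Fin n) (Fin n) ℝ) (hH : H.PosSemidef)
    (g g1 g2 A : ℝ) (hg : 0 < g) (hA : A ≤ 2) (hgg : g * g2 ≤ A * g1 ^ 2)
    (htr : ∑ i, H i i = g) (q : Fin n → ℝ) (s : Fin n → ℝ)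
    (hs : ∀ k, s k = g * g1 * q k - ∑ i, ∑ j, H i j * T k i j) :
    g1 ^ 2 * (∑ i, q i * q i) + g2 * (g * (∑ i, q i * q i) - ∑ i, q i * (H *ᵥ q) i)
      - ∑ k, ∑ i, ∑ j, T k i j ^ 2
      ≤ ∑ k, (2 * g1 / g * (3 * q k - 2 / g * (H *ᵥ q) k)) * s k := by
  have hb := mat_b H hH q
  rw [htr] at hb
  set y : Fin n → ℝ := (3:ℝ) • q - (2 / g) • (H *ᵥ q) with hy
  have hc := mat_c H hH g hg htr q y hy
  have hsym : ∀ i j, H i j = H j i := fun i j => by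
    have := hH.isHermitian.apply i j
    simpa using this.symm
  have ht := tensor T h1 h2 H hsym ((g1 / g) • y)
  set Q := ∑ i, q i * q i with hQ
  set R := ∑ i, q i * (H *ᵥ q) i with hR
  have hqy : ∑ i, q i * y i = 3 * Q - 2 / g * R := by
    rw [hQ, hR, Finset.mul_sum, Finset.mul_sum, ← Finset.sum_sub_distrib]
    refine Finset.sum_congr rfl fun i _ => ?_
    simp [hy]; ring
  have e1 : ∑ i, ((g1 / g) • y) i * ((g1 / g) • y) i = (g1 / g) ^ 2 * ∑ i, y i * y i := by
    rw [Finset.mul_sum]; refine Finset.sum_congr rfl fun i _ => ?_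
    simp; ring
  have e2 : ∑ i, (H *ᵥ ((g1 / g) • y)) i * (H *ᵥ ((g1 / g) • y)) i
      = (g1 / g) ^ 2 * ∑ i, (H *ᵥ y) i * (H *ᵥ y) i := by
    rw [Finset.mul_sum]; refine Finset.sum_congr rfl fun i _ => ?_
    simp [Matrix.mulVec_smul]; ring
  have e3 : ∑ k, ((g1 / g) • y) k * ∑ i, ∑ j, H i j * T k i j
      = g1 ^ 2 * ∑ i, q i * y i - (g1 / g) * ∑ k, y k * s k := by
    rw [Finset.mul_sum, Finset.mul_sum, ← Finset.sum_sub_distrib]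
    refine Finset.sum_congr rfl fun k _ => ?_
    have : ∑ i, ∑ j, H i j * T k i j = g * g1 * q k - s k := by rw [hs]; ring
    rw [this]; simp; field_simp
  have e4 : ∑ k, (2 * g1 / g * (3 * q k - 2 / g * (H *ᵥ q) k)) * s k = 2 * ((g1 / g) * ∑ k, y k * s k) := by
    rw [Finset.mul_sum, Finset.mul_sum]
    refine Finset.sum_congr rfl fun k _ => ?_
    simp [hy]; ring
  rw [e1, e2, e3] at ht
  rw [e4]
  have k1 : (g1 / g) ^ 2 * ((∑ i, ∑ j, H i j ^ 2) * (∑ i, y i * y i) + 2 * ∑ i, (H *ᵥ y) i * (H *ᵥ y) i)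
      ≤ 3 * (g1 ^ 2 * ∑ i, q i * y i) := by
    calc _ ≤ (g1 / g) ^ 2 * (3 * g ^ 2 * ∑ i, q i * y i) := by gcongr
      _ = _ := by field_simp
  have k2 : g2 * (g * Q - R) ≤ 2 * g1 ^ 2 * Q - 2 / g * g1 ^ 2 * R := by
    have a1 : g2 ≤ 2 * g1 ^ 2 / g := by
      rw [le_div_iff₀ hg]; nlinarith [sq_nonneg g1]
    have a2 := mul_le_mul_of_nonneg_right a1 (sub_nonneg.mpr hb)
    have a3 : 2 * g1 ^ 2 / g * (g * Q - R) = 2 * g1 ^ 2 * Q - 2 / g * g1 ^ 2 * R := by field_simp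
    linarith
  have k3 : g1 ^ 2 * ∑ i, q i * y i = 3 * g1 ^ 2 * Q - 2 / g * g1 ^ 2 * R := by rw [hqy]; ring
  linarith

theorem stmt_1 (n : ℕ) (hn : 2 ≤ n)
    (Ω : Set (EuclideanSpace ℝ (Fin n))) (hΩopen : IsOpen Ω) (hΩconn : IsConnected Ω)
    (G : ℝ → ℝ) (A : ℝ) (hApos : 0 < A) (hA2 : A ≤ 2)
    (hG : ContDiff ℝ (⊤ : ℕ∞) G)
    (hGpos : ∀ t, 0 < G t)
    (hG' : ∀ t, deriv G t < 0)
    (hGG'' : ∀ t, G t * deriv (deriv G) t ≤ A * (deriv G t) ^ 2)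
    (u : EuclideanSpace ℝ (Fin n) → ℝ) (hu : ContDiffOn ℝ (⊤ : ℕ∞) u Ω)
    (hconv : ∀ x ∈ Ω, (hessian u x).PosSemidef)
    (heq : ∀ x ∈ Ω, ∑ i, hessian u x i i = G (u x))
    (p : EuclideanSpace ℝ (Fin n)) (hp : p ∈ Ω)
    (hmin : IsLocalMin (fun x => sigma2 (hessian u x)) p) :
    ∀ x ∈ Ω, (hessian u x).rank = 1 := by
  have hG1 : ∀ t, HasDerivAt G (deriv G t) t := fun t => (hG.differentiable (by simp) t).hasDerivAt
  have hGd : ContDiff ℝ (⊤ : ℕ∞) (deriv G) := by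
    have := hG.iterate_deriv 1
    simpa using this
  have hG2 : ∀ t, HasDerivAt (deriv G) (deriv (deriv G) t) t :=
    fun t => (hGd.differentiable (by simp) t).hasDerivAt
  have s1 : ∀ i, ContDiffOn ℝ (⊤ : ℕ∞) (Dp i u) Ω := fun i => Dp_smooth hΩopen hu i
  have s2 : ∀ i j, ContDiffOn ℝ (⊤ : ℕ∞) (Dp i (Dp j u)) Ω := fun i j => Dp_smooth hΩopen (s1 j) i
  have s3 : ∀ k i j, ContDiffOn ℝ (⊤ : ℕ∞) (Dp k (Dp i (Dp j u))) Ω :=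
    fun k i j => Dp_smooth hΩopen (s2 i j) k
  have hsymm : ∀ k i j, ∀ x ∈ Ω, Dp k (Dp i (Dp j u)) x = Dp i (Dp k (Dp j u)) x :=
    fun k i j x hx => Dp_comm hΩopen (s1 j) k i hx
  have hsymm' : ∀ k i j, ∀ x ∈ Ω, Dp k (Dp i (Dp j u)) x = Dp k (Dp j (Dp i u)) x :=
    fun k i j x hx => Dp_congr hΩopen (fun y hy => Dp_comm hΩopen hu i j hy) k hx
  have heq' : ∀ x ∈ Ω, ∑ i, Dp i (Dp i u) x = G (u x) := by
    intro x hx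
    rw [← heq x hx]
    exact Finset.sum_congr rfl fun i _ => (hess_Dp hΩopen hu i i hx).symm
  -- Laplacian of second derivatives
  have e1 : ∀ j, ∀ x ∈ Ω, ∑ k, Dp k (Dp k (Dp j u)) x = deriv G (u x) * Dp j u x := by
    intro j x hx
    have h : HasLineDerivAt ℝ (fun x => ∑ k, Dp k (Dp k u) x) (∑ k, Dp j (Dp k (Dp k u)) x) x
        (EuclideanSpace.basisFun (Fin n) ℝ j) :=
      hl_sum _ fun k _ => Dp_hl hΩopen (s2 k k) j hx
    have h' := hl_comp (hG1 (u x)) (Dp_hl hΩopen hu j hx)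
    have h'' := hl_congr h (g := fun x => G (u x)) (g' := ∑ k, Dp j (Dp k (Dp k u)) x)
      (by filter_upwards [hΩopen.mem_nhds hx] with y hy using heq' y hy) rfl
    rw [← h''.unique h']
    refine Finset.sum_congr rfl fun k _ => ?_
    rw [hsymm' k k j x hx, hsymm k j k x hx]
  have e2 : ∀ i j, ∀ x ∈ Ω, ∑ k, Dp k (Dp k (Dp i (Dp j u))) x
      = deriv (deriv G) (u x) * Dp i u x * Dp j u x + deriv G (u x) * Dp i (Dp j u) x := by
    intro i j x hx
    have h : HasLineDerivAt ℝ (fun x => ∑ k, Dp k (Dp k (Dp j u)) x) (∑ k, Dp i (Dp k (Dp k (Dp j u))) x) x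
        (EuclideanSpace.basisFun (Fin n) ℝ i) :=
      hl_sum _ fun k _ => Dp_hl hΩopen (s3 k k j) i hx
    have h' := hl_mul (hl_comp (hG2 (u x)) (Dp_hl hΩopen hu i hx)) (Dp_hl hΩopen (s1 j) i hx)
    have h'' := hl_congr h (g := fun x => deriv G (u x) * Dp j u x) (g' := ∑ k, Dp i (Dp k (Dp k (Dp j u))) x)
      (by filter_upwards [hΩopen.mem_nhds hx] with y hy using e1 j y hy) rfl
    rw [← h''.unique h']
    refine Finset.sum_congr rfl fun k _ => ?_
    rw [Dp_comm hΩopen (s2 k j) i k hx]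
    exact Dp_congr hΩopen (fun y hy => hsymm k i j y hy) k hx
  set S : EuclideanSpace ℝ (Fin n) → ℝ := fun x => sigma2 (hessian u x) with hS
  set S1 : Fin n → EuclideanSpace ℝ (Fin n) → ℝ := fun k x =>
    G (u x) * (deriv G (u x) * Dp k u x) - ∑ i, ∑ j, Dp i (Dp j u) x * Dp k (Dp i (Dp j u)) x with hS1
  set S2 : Fin n → EuclideanSpace ℝ (Fin n) → ℝ := fun k x =>
    (deriv G (u x) * Dp k u x) * (deriv G (u x) * Dp k u x)
      + G (u x) * (deriv (deriv G) (u x) * Dp k u x * Dp k u x + deriv G (u x) * Dp k (Dp k u) x)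
      - ∑ i, ∑ j, (Dp k (Dp i (Dp j u)) x * Dp k (Dp i (Dp j u)) x
        + Dp i (Dp j u) x * Dp k (Dp k (Dp i (Dp j u))) x) with hS2
  have hSeq : ∀ x ∈ Ω, S x = (G (u x) * G (u x) - ∑ i, ∑ j, Dp i (Dp j u) x * Dp i (Dp j u) x) / 2 := by
    intro x hx
    simp only [hS, sigma2, hess_Dp hΩopen hu _ _ hx, sq, heq' x hx]
  have d1 : ∀ k, ∀ x ∈ Ω, HasLineDerivAt ℝ S (S1 k x) x (EuclideanSpace.basisFun (Fin n) ℝ k) := by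
    intro k x hx
    have hGu := hl_comp (hG1 (u x)) (Dp_hl hΩopen hu k hx)
    have hs : HasLineDerivAt ℝ (fun x => ∑ i, ∑ j, Dp i (Dp j u) x * Dp i (Dp j u) x)
        (∑ i, ∑ j, (Dp k (Dp i (Dp j u)) x * Dp i (Dp j u) x + Dp i (Dp j u) x * Dp k (Dp i (Dp j u)) x)) x
        (EuclideanSpace.basisFun (Fin n) ℝ k) :=
      hl_sum _ fun i _ => hl_sum _ fun j _ =>
        hl_mul (Dp_hl hΩopen (s2 i j) k hx) (Dp_hl hΩopen (s2 i j) k hx)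
    refine hl_congr (hl_mul (hl_sub (hl_mul hGu hGu) hs) (hl_const (1 / 2))) ?_ ?_
    · filter_upwards [hΩopen.mem_nhds hx] with y hy
      rw [hSeq y hy]; ring
    · have : ∑ i, ∑ j, (Dp k (Dp i (Dp j u)) x * Dp i (Dp j u) x + Dp i (Dp j u) x * Dp k (Dp i (Dp j u)) x)
        = 2 * ∑ i, ∑ j, Dp i (Dp j u) x * Dp k (Dp i (Dp j u)) x := by
        simp only [Finset.mul_sum]
        refine Finset.sum_congr rfl fun i _ => Finset.sum_congr rfl fun j _ => by ring
      rw [this]; simp only [hS1]; ring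
  have d2 : ∀ k, ∀ x ∈ Ω, HasLineDerivAt ℝ (S1 k) (S2 k x) x (EuclideanSpace.basisFun (Fin n) ℝ k) := by
    intro k x hx
    have hGu := hl_comp (hG1 (u x)) (Dp_hl hΩopen hu k hx)
    have hGu' := hl_mul (hl_comp (hG2 (u x)) (Dp_hl hΩopen hu k hx)) (Dp_hl hΩopen (s1 k) k hx)
    have hs : HasLineDerivAt ℝ (fun x => ∑ i, ∑ j, Dp i (Dp j u) x * Dp k (Dp i (Dp j u)) x)
        (∑ i, ∑ j, (Dp k (Dp i (Dp j u)) x * Dp k (Dp i (Dp j u)) x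
          + Dp i (Dp j u) x * Dp k (Dp k (Dp i (Dp j u))) x)) x
        (EuclideanSpace.basisFun (Fin n) ℝ k) :=
      hl_sum _ fun i _ => hl_sum _ fun j _ =>
        hl_mul (Dp_hl hΩopen (s2 i j) k hx) (Dp_hl hΩopen (s3 k i j) k hx)
    exact hl_sub (hl_mul hGu hGu') hs
  set b : Fin n → EuclideanSpace ℝ (Fin n) → ℝ := fun k x =>
    2 * deriv G (u x) / G (u x) * (3 * Dp k u x - 2 / G (u x) * ∑ j, Dp k (Dp j u) x * Dp j u x) with hb
  have main : ∀ x ∈ Ω, ∑ k, S2 k x ≤ ∑ k, b k x * S1 k x + 2 * deriv G (u x) * S x := by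
    intro x hx
    have hH : ∀ i j, hessian u x i j = Dp i (Dp j u) x := fun i j => hess_Dp hΩopen hu i j hx
    have hmv : ∀ i, (hessian u x *ᵥ fun k => Dp k u x) i = ∑ j, Dp i (Dp j u) x * Dp j u x := by
      intro i; simp only [Matrix.mulVec, dotProduct, hH]
    have ha := alg_final (fun k i j => Dp k (Dp i (Dp j u)) x) (fun i j k => hsymm i j k x hx)
      (fun i j k => hsymm' i j k x hx) (hessian u x) (hconv x hx) (G (u x)) (deriv G (u x))
      (deriv (deriv G) (u x)) A (hGpos _) hA2 (hGG'' _) (heq x hx) (fun k => Dp k u x)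
      (fun k => S1 k x) (fun k => by simp only [hS1, hH]; ring)
    simp only [hmv] at ha
    have hbS : ∑ k, b k x * S1 k x = ∑ k, (2 * deriv G (u x) / G (u x) * (3 * Dp k u x - 2 / G (u x) * ∑ j, Dp k (Dp j u) x * Dp j u x)) * S1 k x := rfl
    rw [hbS]
    have hLap : ∑ k, ∑ i, ∑ j, Dp i (Dp j u) x * Dp k (Dp k (Dp i (Dp j u))) x
        = deriv (deriv G) (u x) * (∑ i, Dp i u x * ∑ j, Dp i (Dp j u) x * Dp j u x)
          + deriv G (u x) * ∑ i, ∑ j, Dp i (Dp j u) x * Dp i (Dp j u) x := by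
      rw [Finset.sum_comm]
      simp only [Finset.mul_sum, ← Finset.sum_add_distrib]
      refine Finset.sum_congr rfl fun i _ => ?_
      rw [Finset.sum_comm]
      refine Finset.sum_congr rfl fun j _ => ?_
      rw [← Finset.mul_sum, e2 i j x hx]; ring
    have hsumS2 : ∑ k, S2 k x = deriv G (u x) ^ 2 * (∑ i, Dp i u x * Dp i u x)
        + G (u x) * deriv (deriv G) (u x) * (∑ i, Dp i u x * Dp i u x)
        + G (u x) * deriv G (u x) * (∑ k, Dp k (Dp k u) x)
        - ∑ k, ∑ i, ∑ j, Dp k (Dp i (Dp j u)) x ^ 2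
        - ∑ k, ∑ i, ∑ j, Dp i (Dp j u) x * Dp k (Dp k (Dp i (Dp j u))) x := by
      simp only [hS2, Finset.mul_sum, Finset.sum_add_distrib, Finset.sum_sub_distrib, mul_add, sq]
      have r1 : ∑ k, deriv G (u x) * Dp k u x * (deriv G (u x) * Dp k u x) =
        ∑ k, deriv G (u x) * deriv G (u x) * (Dp k u x * Dp k u x) :=
        Finset.sum_congr rfl fun k _ => by ring
      have r2 : ∑ k, G (u x) * (deriv (deriv G) (u x) * Dp k u x * Dp k u x) =
        ∑ k, G (u x) * deriv (deriv G) (u x) * (Dp k u x * Dp k u x) :=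
        Finset.sum_congr rfl fun k _ => by ring
      have r3 : ∑ k, G (u x) * (deriv G (u x) * Dp k (Dp k u) x) =
        ∑ k, G (u x) * deriv G (u x) * Dp k (Dp k u) x :=
        Finset.sum_congr rfl fun k _ => by ring
      rw [r1, r2, r3]; ring
    rw [hsumS2, hLap, heq' x hx, hSeq x hx]
    linarith
  have hnn : ∀ x ∈ Ω, 0 ≤ S x := fun x hx => mat_a _ (hconv x hx)
  have hSc : ContinuousOn S Ω := by
    have : ContinuousOn (fun x => (G (u x) * G (u x) - ∑ i, ∑ j, Dp i (Dp j u) x * Dp i (Dp j u) x) / 2) Ω := by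
      have c1 : ContinuousOn (fun x => G (u x)) Ω := hG.continuous.comp_continuousOn hu.continuousOn
      have c2 : ∀ i j, ContinuousOn (Dp i (Dp j u)) Ω := fun i j => (s2 i j).continuousOn
      exact ((c1.mul c1).sub (continuousOn_finsetSum _ fun i _ => continuousOn_finsetSum _ fun j _ =>
        (c2 i j).mul (c2 i j))).div_const 2
    exact this.congr hSeq
  have hbc : ∀ k, ContinuousOn (b k) Ω := by
    intro k
    have c1 : ContinuousOn (fun x => G (u x)) Ω := hG.continuous.comp_continuousOn hu.continuousOn
    have c0 : ContinuousOn (fun x => deriv G (u x)) Ω := hGd.continuous.comp_continuousOn hu.continuousOn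
    have c2 : ∀ i j, ContinuousOn (Dp i (Dp j u)) Ω := fun i j => (s2 i j).continuousOn
    have c3 : ∀ i, ContinuousOn (Dp i u) Ω := fun i => (s1 i).continuousOn
    have hne : ∀ x ∈ Ω, G (u x) ≠ 0 := fun x _ => (hGpos _).ne'
    exact ((continuousOn_const.mul c0).div c1 hne).mul ((continuousOn_const.mul (c3 k)).sub
      ((continuousOn_const.div c1 hne).mul (continuousOn_finsetSum _ fun j _ => (c2 k j).mul (c3 j))))
  have hSp : S p = 0 := by
    have ht : ∀ k, S1 k p = 0 ∧ 0 ≤ S2 k p := fun k =>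
      second_test S (S1 k) _ p _ (by filter_upwards [hΩopen.mem_nhds hp] with y hy using d1 k y hy)
        (d2 k p hp) hmin
    have hm := main p hp
    have h0 : 0 ≤ ∑ k, S2 k p := Finset.sum_nonneg fun k _ => (ht k).2
    have h00 : ∑ k, b k p * S1 k p = 0 := Finset.sum_eq_zero fun k _ => by rw [(ht k).1, mul_zero]
    have := hnn p hp
    have hg := hG' (u p)
    nlinarith
  have hzero := strong_min Ω hΩopen hΩconn S S1 S2 b hSc d1 d2 hbc (fun x hx => by
    have := main x hx
    have h1 := hnn x hx
    have h2 := hG' (u x)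
    nlinarith) hnn p hp hSp
  intro x hx
  exact mat_rank _ (hconv x hx) (by rw [heq x hx]; exact hGpos _) (hzero x hx)
end
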